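/- arXiv:2211.03221 — 10 statements merged into one kernel-verified Lean document; each statement's English description precedes it below -/
import Mathlib

section
/- Let (Ω, 𝓕, P) be a probability space and Y : Ω → ℝ a random variable. Let a < b be real numbers such that E[e^{aY}], E[e^{bY}], E[|Y|·e^{aY}], and E[|Y|·e^{bY}] are all finite. Then for every real number c satisfying E[Y·e^{aY}]/E[e^{aY}] < c < E[Y·e^{bY}]/E[e^{bY}], there exists a unique η in the open interval (−b, −a) such that the function ω ↦ e^{−η·Y(ω)}·(Y(ω) − c) is P-integrable and E[e^{−η·Y}·(Y − c)] = 0. -/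
open MeasureTheory Real

theorem strictMono_mul_exp_mul {z : ℝ} (hz : z ≠ 0) : StrictMono fun t : ℝ => z * exp (t * z) := by
  intro s t hst
  rcases hz.lt_or_gt with hneg | hpos
  · exact mul_lt_mul_of_neg_left (exp_lt_exp.2 (mul_lt_mul_of_neg_right hst hneg)) hneg
  · exact mul_lt_mul_of_pos_left (exp_lt_exp.2 (mul_lt_mul_of_pos_right hst hpos)) hpos

theorem monotone_mul_exp_mul (z : ℝ) : Monotone fun t : ℝ => z * exp (t * z) := by
  rcases eq_or_ne z 0 with rfl | hz
  · simpa using monotone_const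
  · exact (strictMono_mul_exp_mul hz).monotone

section TiltedMoment

variable {Ω : Type*} [MeasurableSpace Ω] {μ : Measure Ω} {Z : Ω → ℝ} {a b : ℝ}

theorem abs_mul_exp_mul_le_add {t : ℝ} (ht : t ∈ Set.Icc a b) (z : ℝ) :
    ‖z * exp (t * z)‖ ≤ ‖z * exp (a * z)‖ + ‖z * exp (b * z)‖ :=
  (abs_le_max_abs_abs (monotone_mul_exp_mul z ht.1) (monotone_mul_exp_mul z ht.2)).trans
    (max_le_add_of_nonneg (abs_nonneg _) (abs_nonneg _))

theorem integrable_mul_exp_mul_of_mem_Icc (hZ : Measurable Z)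
    (ha : Integrable (fun ω => Z ω * exp (a * Z ω)) μ)
    (hb : Integrable (fun ω => Z ω * exp (b * Z ω)) μ) {t : ℝ} (ht : t ∈ Set.Icc a b) :
    Integrable (fun ω => Z ω * exp (t * Z ω)) μ :=
  (ha.norm.add hb.norm).mono' (by fun_prop) (.of_forall fun ω => abs_mul_exp_mul_le_add ht (Z ω))

theorem continuousOn_integral_mul_exp_mul (hZ : Measurable Z)
    (ha : Integrable (fun ω => Z ω * exp (a * Z ω)) μ)
    (hb : Integrable (fun ω => Z ω * exp (b * Z ω)) μ) :
    ContinuousOn (fun t => ∫ ω, Z ω * exp (t * Z ω) ∂μ) (Set.Icc a b) :=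
  continuousOn_of_dominated (fun t _ => by fun_prop)
    (fun t ht => .of_forall fun ω => abs_mul_exp_mul_le_add ht (Z ω)) (ha.norm.add hb.norm)
    (.of_forall fun ω => by fun_prop)

theorem strictMonoOn_integral_mul_exp_mul (hZ : Measurable Z) (hZ0 : ¬ Z =ᵐ[μ] 0)
    (ha : Integrable (fun ω => Z ω * exp (a * Z ω)) μ)
    (hb : Integrable (fun ω => Z ω * exp (b * Z ω)) μ) :
    StrictMonoOn (fun t => ∫ ω, Z ω * exp (t * Z ω) ∂μ) (Set.Icc a b) := by
  intro s hs t ht hst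
  have his := integrable_mul_exp_mul_of_mem_Icc hZ ha hb hs
  have hit := integrable_mul_exp_mul_of_mem_Icc hZ ha hb ht
  have hle : (fun ω => Z ω * exp (s * Z ω)) ≤ᵐ[μ] fun ω => Z ω * exp (t * Z ω) :=
    .of_forall fun ω => monotone_mul_exp_mul (Z ω) hst.le
  refine (integral_mono_ae his hit hle).lt_of_ne fun heq => hZ0 ?_
  filter_upwards [(integral_eq_iff_of_ae_le his hit hle).1 heq] with ω hω
  by_contra hne
  exact (strictMono_mul_exp_mul hne hst).ne hω

theorem existsUnique_integral_mul_exp_mul_eq_zero (hZ : Measurable Z) (hab : a < b)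
    (ha : Integrable (fun ω => Z ω * exp (a * Z ω)) μ)
    (hb : Integrable (fun ω => Z ω * exp (b * Z ω)) μ)
    (hneg : ∫ ω, Z ω * exp (a * Z ω) ∂μ < 0) (hpos : 0 < ∫ ω, Z ω * exp (b * Z ω) ∂μ) :
    ∃! t : ℝ, t ∈ Set.Ioo a b ∧ ∫ ω, Z ω * exp (t * Z ω) ∂μ = 0 := by
  have hZ0 : ¬ Z =ᵐ[μ] 0 := fun h => hneg.ne <| integral_eq_zero_of_ae <| by
    filter_upwards [h] with ω hω
    simp [hω]
  obtain ⟨t, ht, ht0⟩ := intermediate_value_Ioo hab.le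
    (continuousOn_integral_mul_exp_mul hZ ha hb) ⟨hneg, hpos⟩
  refine ⟨t, ⟨ht, ht0⟩, fun s ⟨hs, hs0⟩ => ?_⟩
  exact (strictMonoOn_integral_mul_exp_mul hZ hZ0 ha hb).injOn (Set.Ioo_subset_Icc_self hs)
    (Set.Ioo_subset_Icc_self ht) (hs0.trans ht0.symm)

end TiltedMoment

theorem sub_mul_exp_mul_sub (y c t : ℝ) :
    (y - c) * exp (t * (y - c)) = exp (-(t * c)) * (y * exp (t * y) - c * exp (t * y)) := by
  rw [show t * (y - c) = -(t * c) + t * y by ring, exp_add]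
  ring

section Shift

variable {Ω : Type*} [MeasurableSpace Ω] {μ : Measure Ω} {Y : Ω → ℝ} {t : ℝ}

theorem integrable_mul_exp_mul_of_abs (hY : Measurable Y)
    (h : Integrable (fun ω => |Y ω| * exp (t * Y ω)) μ) :
    Integrable (fun ω => Y ω * exp (t * Y ω)) μ :=
  h.mono' (by fun_prop) (.of_forall fun ω => by simp)

theorem integrable_sub_mul_exp_mul_sub (c : ℝ) (h : Integrable (fun ω => exp (t * Y ω)) μ)
    (h' : Integrable (fun ω => Y ω * exp (t * Y ω)) μ) :
    Integrable (fun ω => (Y ω - c) * exp (t * (Y ω - c))) μ := by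
  simp_rw [sub_mul_exp_mul_sub]
  exact (h'.sub (h.const_mul c)).const_mul _

theorem integral_sub_mul_exp_mul_sub (c : ℝ) (h : Integrable (fun ω => exp (t * Y ω)) μ)
    (h' : Integrable (fun ω => Y ω * exp (t * Y ω)) μ) :
    ∫ ω, (Y ω - c) * exp (t * (Y ω - c)) ∂μ =
      exp (-(t * c)) * (∫ ω, Y ω * exp (t * Y ω) ∂μ - c * ∫ ω, exp (t * Y ω) ∂μ) := by
  simp_rw [sub_mul_exp_mul_sub]
  rw [integral_const_mul, integral_sub h' (h.const_mul c), integral_const_mul]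

end Shift

/-- existence and uniqueness of the exponential-tilting parameter
matching a given tilted mean `c` strictly between the tilted means at `a` and `b`. -/
theorem stmt_0 {Ω : Type*} [MeasurableSpace Ω] (P : Measure Ω) [IsProbabilityMeasure P]
    (Y : Ω → ℝ) (hY : Measurable Y) (a b : ℝ) (hab : a < b)
    (ha : Integrable (fun ω => exp (a * Y ω)) P)
    (hb : Integrable (fun ω => exp (b * Y ω)) P)
    (ha' : Integrable (fun ω => |Y ω| * exp (a * Y ω)) P)
    (hb' : Integrable (fun ω => |Y ω| * exp (b * Y ω)) P)
    (c : ℝ)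
    (hc1 : (∫ ω, Y ω * exp (a * Y ω) ∂P) / (∫ ω, exp (a * Y ω) ∂P) < c)
    (hc2 : c < (∫ ω, Y ω * exp (b * Y ω) ∂P) / (∫ ω, exp (b * Y ω) ∂P)) :
    ∃! η : ℝ, η ∈ Set.Ioo (-b) (-a) ∧
      Integrable (fun ω => exp (-η * Y ω) * (Y ω - c)) P ∧
      ∫ ω, exp (-η * Y ω) * (Y ω - c) ∂P = 0 := by
  have hZ : Measurable fun ω => Y ω - c := hY.sub_const c
  have ha'' := integrable_mul_exp_mul_of_abs hY ha'
  have hb'' := integrable_mul_exp_mul_of_abs hY hb'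
  have hZa := integrable_sub_mul_exp_mul_sub c ha ha''
  have hZb := integrable_sub_mul_exp_mul_sub c hb hb''
  have hneg : ∫ ω, (Y ω - c) * exp (a * (Y ω - c)) ∂P < 0 := by
    rw [integral_sub_mul_exp_mul_sub c ha ha'']
    exact mul_neg_of_pos_of_neg (exp_pos _)
      (sub_neg.2 ((div_lt_iff₀ (integral_exp_pos ha)).1 hc1))
  have hpos : 0 < ∫ ω, (Y ω - c) * exp (b * (Y ω - c)) ∂P := by
    rw [integral_sub_mul_exp_mul_sub c hb hb'']
    exact mul_pos (exp_pos _) (sub_pos.2 ((lt_div_iff₀ (integral_exp_pos hb)).1 hc2))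
  have hfactor (η : ℝ) (ω : Ω) : exp (-η * Y ω) * (Y ω - c) =
      exp (-η * c) * ((Y ω - c) * exp (-η * (Y ω - c))) := by
    rw [show -η * Y ω = -η * c + -η * (Y ω - c) by ring, exp_add]
    ring
  obtain ⟨t, ⟨ht, ht0⟩, huniq⟩ :=
    existsUnique_integral_mul_exp_mul_eq_zero hZ hab hZa hZb hneg hpos
  refine ⟨-t, ⟨⟨neg_lt_neg ht.2, neg_lt_neg ht.1⟩, ?_, ?_⟩, fun η ⟨hη, _, hη0⟩ => ?_⟩
  · simp_rw [hfactor, neg_neg]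
    exact (integrable_mul_exp_mul_of_mem_Icc hZ hZa hZb (Set.Ioo_subset_Icc_self ht)).const_mul _
  · simp_rw [hfactor, neg_neg]
    rw [integral_const_mul, ht0, mul_zero]
  · simp_rw [hfactor] at hη0
    rw [integral_const_mul] at hη0
    exact neg_eq_iff_eq_neg.1 (huniq (-η) ⟨⟨lt_neg_of_lt_neg hη.2, neg_lt_of_neg_lt hη.1⟩,
      (mul_eq_zero.1 hη0).resolve_left (exp_ne_zero _)⟩)
end

section
/- Let (Ω, 𝓕, P) be a probability space and Y : Ω → ℝ a random variable that is not P-almost surely equal to a constant. Let a < b be real numbers such that E[e^{sY}] < ∞ for every s ∈ (a, b). Then for each s ∈ (a, b) the function ω ↦ |Y(ω)|·e^{s·Y(ω)} is P-integrable, and the tilted mean map s ↦ E[Y·e^{sY}]/E[e^{sY}] is strictly monotone increasing on (a, b). -/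
open MeasureTheory Real

theorem mem_interior_integrableExpSet_of_Ioo {Ω : Type*} [MeasurableSpace Ω] {P : Measure Ω}
    {Y : Ω → ℝ} {a b : ℝ}
    (hmgf : ∀ s ∈ Set.Ioo a b, Integrable (fun ω => exp (s * Y ω)) P)
    {s : ℝ} (hs : s ∈ Set.Ioo a b) :
    s ∈ interior (ProbabilityTheory.integrableExpSet Y P) :=
  interior_maximal (fun t ht => hmgf t ht) isOpen_Ioo hs

/-- The product of two increments of functions increasing in `y` is positive off the diagonal. -/
theorem sub_mul_exp_sub_exp_pos {s t y m : ℝ} (hst : s < t) (h : y ≠ m) :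
    0 < (y - m) * (exp (t * y) - exp ((t - s) * m) * exp (s * y)) := by
  rw [← exp_add]
  rcases lt_or_gt_of_ne h with h | h
  · apply mul_pos_of_neg_of_neg (by linarith)
    rw [sub_neg, exp_lt_exp]
    nlinarith
  · apply mul_pos (by linarith)
    rw [sub_pos, exp_lt_exp]
    nlinarith

/-- integrability of `|Y| e^{sY}` and strict monotonicity of the tilted
mean map `s ↦ E[Y e^{sY}] / E[e^{sY}]` on `(a,b)`, for a non-(a.s.-)constant `Y`. -/
theorem stmt_1 {Ω : Type*} [MeasurableSpace Ω] (P : Measure Ω) [IsProbabilityMeasure P]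
    (Y : Ω → ℝ) (hY : Measurable Y)
    (hconst : ¬ ∃ r : ℝ, Y =ᵐ[P] fun _ => r)
    (a b : ℝ) (hab : a < b)
    (hmgf : ∀ s ∈ Set.Ioo a b, Integrable (fun ω => exp (s * Y ω)) P) :
    (∀ s ∈ Set.Ioo a b, Integrable (fun ω => |Y ω| * exp (s * Y ω)) P) ∧
    StrictMonoOn (fun s => (∫ ω, Y ω * exp (s * Y ω) ∂P) / (∫ ω, exp (s * Y ω) ∂P))
      (Set.Ioo a b) := by
  have hint : ∀ s ∈ Set.Ioo a b, Integrable (fun ω => Y ω * exp (s * Y ω)) P := fun s hs => by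
    simpa using ProbabilityTheory.integrable_pow_mul_exp_of_mem_interior_integrableExpSet
      (mem_interior_integrableExpSet_of_Ioo hmgf hs) 1
  refine ⟨fun s hs => by simpa [abs_mul] using (hint s hs).abs, fun s hs t ht hst => ?_⟩
  have hs_pos := integral_exp_pos (hmgf s hs)
  have ht_pos := integral_exp_pos (hmgf t ht)
  simp only
  rw [lt_div_iff₀ ht_pos]
  set m := (∫ ω, Y ω * exp (s * Y ω) ∂P) / (∫ ω, exp (s * Y ω) ∂P) with hm
  have hm_eq : (∫ ω, Y ω * exp (s * Y ω) ∂P) = m * ∫ ω, exp (s * Y ω) ∂P := by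
    rw [hm, div_mul_cancel₀ _ hs_pos.ne']
  set c := exp ((t - s) * m) with hc
  have hexpand : (fun ω => (Y ω - m) * (exp (t * Y ω) - c * exp (s * Y ω))) =
      fun ω => (Y ω * exp (t * Y ω) - m * exp (t * Y ω)) -
        c * (Y ω * exp (s * Y ω) - m * exp (s * Y ω)) := by
    funext ω
    ring
  have hdiff : ∀ u ∈ Set.Ioo a b,
      Integrable (fun ω => Y ω * exp (u * Y ω) - m * exp (u * Y ω)) P :=
    fun u hu => (hint u hu).sub ((hmgf u hu).const_mul m)
  have hF_int : Integrable (fun ω => (Y ω - m) * (exp (t * Y ω) - c * exp (s * Y ω))) P := by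
    rw [hexpand]
    exact (hdiff t ht).sub ((hdiff s hs).const_mul c)
  have hF_eq : ∫ ω, (Y ω - m) * (exp (t * Y ω) - c * exp (s * Y ω)) ∂P =
      (∫ ω, Y ω * exp (t * Y ω) ∂P) - m * ∫ ω, exp (t * Y ω) ∂P := by
    rw [hexpand, integral_sub (hdiff t ht) ((hdiff s hs).const_mul c), integral_const_mul,
      integral_sub (hint t ht) ((hmgf t ht).const_mul m),
      integral_sub (hint s hs) ((hmgf s hs).const_mul m), integral_const_mul, integral_const_mul,
      hm_eq]
    ring
  have hF_nonneg : 0 ≤ fun ω => (Y ω - m) * (exp (t * Y ω) - c * exp (s * Y ω)) := fun ω => by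
    by_cases h : Y ω = m
    · simp [h]
    · exact (sub_mul_exp_sub_exp_pos hst h).le
  rw [← sub_pos, ← hF_eq]
  refine (integral_nonneg hF_nonneg).lt_of_ne' fun h0 => hconst ⟨m, ?_⟩
  filter_upwards [(integral_eq_zero_iff_of_nonneg hF_nonneg hF_int).1 h0] with ω hω
  by_contra h
  exact (sub_mul_exp_sub_exp_pos hst h).ne' hω
end

section
/- Let P be a probability measure on a measurable space Ω, let f₁,…,f_n : Ω → ℝ be measurable, let η₁,…,η_n ∈ ℝ, set g := exp(−∑ᵢ ηᵢ fᵢ), assume 0 < Z := ∫ g dP < ∞, and let Q* := P.withDensity(g/Z). Assume each fᵢ is Q*-integrable. Then Q* is a probability measure, and for every probability measure Q on Ω such that Q ≪ P, each fᵢ is Q-integrable, and ∫ fᵢ dQ = ∫ fᵢ dQ* for all i = 1,…,n, one has klDiv(Q* ∥ P) ≤ klDiv(Q ∥ P); moreover klDiv(Q ∥ P) = klDiv(Q* ∥ P) holds only if Q = Q*. -/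
open MeasureTheory Real
open scoped ENNReal Classical

/-- The Kullback–Leibler divergence of `Q` with respect to `P`, valued in `[0,∞]`:
`∫ log (dQ/dP) dQ` when `Q ≪ P` and this integral is defined, and `∞` otherwise. -/
noncomputable def klDiv {Ω : Type*} [MeasurableSpace Ω] (Q P : Measure Ω) : ℝ≥0∞ :=
  if Q ≪ P ∧ Integrable (llr Q P) Q then ENNReal.ofReal (∫ ω, llr Q P ω ∂Q) else ∞

open InformationTheory in
/-- The Gibbs inequality for probability measures. -/
lemma integral_llr_nonneg_of_isProbabilityMeasure {Ω : Type*} [MeasurableSpace Ω]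
    {Q P : Measure Ω} [IsProbabilityMeasure Q] [IsProbabilityMeasure P] (hQP : Q ≪ P)
    (hint : Integrable (llr Q P) Q) : 0 ≤ ∫ ω, llr Q P ω ∂Q := by
  simpa using integral_llr_add_sub_measure_univ_nonneg hQP hint

/-- The equality case of the Gibbs inequality for probability measures. -/
lemma eq_of_integral_llr_eq_zero {Ω : Type*} [MeasurableSpace Ω]
    {Q P : Measure Ω} [IsProbabilityMeasure Q] [IsProbabilityMeasure P] (hQP : Q ≪ P)
    (hint : Integrable (llr Q P) Q) (h : ∫ ω, llr Q P ω ∂Q = 0) : Q = P := by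
  refine InformationTheory.klDiv_eq_zero_iff.1 ?_
  simp [InformationTheory.klDiv_of_ac_of_integrable hQP hint, h]

/-- The log-density of a tilted measure with respect to its base measure. -/
lemma llr_tilted_self {Ω : Type*} [MeasurableSpace Ω] {P : Measure Ω} [IsProbabilityMeasure P]
    {F : Ω → ℝ} (hF : Integrable (fun ω => exp (F ω)) P) :
    llr (P.tilted F) P =ᵐ[P.tilted F] fun ω => F ω - log (∫ ω, exp (F ω) ∂P) :=
  (tilted_absolutelyContinuous P F).ae_le (log_rnDeriv_tilted_left_self hF)

/-- Among probability measures `Q` with `∫ F dQ = ∫ F d(P.tilted F)`, the tilted measure is the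
unique minimizer of the Kullback–Leibler divergence to `P`. -/
lemma klDiv_tilted_le_and_eq_of_eq {Ω : Type*} [MeasurableSpace Ω] {P Q : Measure Ω}
    [IsProbabilityMeasure P] [IsProbabilityMeasure Q] {F : Ω → ℝ}
    (hF : Integrable (fun ω => exp (F ω)) P) (hFP : Integrable F (P.tilted F))
    (hFQ : Integrable F Q) (hFeq : ∫ ω, F ω ∂Q = ∫ ω, F ω ∂(P.tilted F)) :
    klDiv (P.tilted F) P ≤ klDiv Q P ∧ (klDiv Q P = klDiv (P.tilted F) P → Q = P.tilted F) := by
  have := isProbabilityMeasure_tilted hF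
  have hac := tilted_absolutelyContinuous P F
  have hint : Integrable (llr (P.tilted F) P) (P.tilted F) :=
    (integrable_congr (llr_tilted_self hF)).2 (hFP.sub (integrable_const _))
  have hval : ∫ ω, llr (P.tilted F) P ω ∂(P.tilted F)
      = ∫ ω, F ω ∂Q - log (∫ ω, exp (F ω) ∂P) := by
    rw [integral_congr_ae (llr_tilted_self hF), integral_sub hFP (integrable_const _), hFeq]
    simp
  have hnonneg := integral_llr_nonneg_of_isProbabilityMeasure hac hint
  simp only [klDiv, hac, hint, and_self, if_true]
  split_ifs with hQ
  · obtain ⟨hQP, hQint⟩ := hQ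
    have hQac : Q ≪ P.tilted F := hQP.trans (absolutelyContinuous_tilted hF)
    have hQint' := integrable_llr_tilted_right hQP hFQ hQint hF
    have hdecomp := integral_llr_tilted_right hQP hFQ hF hQint
    have hgibbs := integral_llr_nonneg_of_isProbabilityMeasure hQac hQint'
    refine ⟨ENNReal.ofReal_le_ofReal (by linarith), fun h => ?_⟩
    rw [ENNReal.ofReal_eq_ofReal_iff
      (integral_llr_nonneg_of_isProbabilityMeasure hQP hQint) hnonneg] at h
    exact eq_of_integral_llr_eq_zero hQac hQint' (by linarith)
  · exact ⟨le_top, fun h => absurd h.symm ENNReal.ofReal_ne_top⟩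

/-- the exponentially tilted measure `Q* = P.withDensity (g/Z)`,
`g = exp(-∑ ηᵢ fᵢ)`, is a probability measure minimizing the KL divergence to `P`
among probability measures `Q ≪ P` matching the moments `∫ fᵢ dQ = ∫ fᵢ dQ*`,
with equality of divergences only for `Q = Q*`. -/
theorem stmt_2 {Ω : Type*} [MeasurableSpace Ω] (P : Measure Ω) [IsProbabilityMeasure P]
    (n : ℕ) (f : Fin n → Ω → ℝ) (hf : ∀ i, Measurable (f i)) (η : Fin n → ℝ)
    (g : Ω → ℝ) (hg : g = fun ω => exp (-∑ i, η i * f i ω))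
    (Z : ℝ) (hZ : Z = ∫ ω, g ω ∂P) (hgint : Integrable g P) (hZpos : 0 < Z)
    (Qstar : Measure Ω)
    (hQstar : Qstar = P.withDensity (fun ω => ENNReal.ofReal (g ω / Z)))
    (hfQstar : ∀ i, Integrable (f i) Qstar) :
    IsProbabilityMeasure Qstar ∧
    ∀ Q : Measure Ω, IsProbabilityMeasure Q → Q ≪ P →
      (∀ i, Integrable (f i) Q) →
      (∀ i, ∫ ω, f i ω ∂Q = ∫ ω, f i ω ∂Qstar) →
      klDiv Qstar P ≤ klDiv Q P ∧ (klDiv Q P = klDiv Qstar P → Q = Qstar) := by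
  set F : Ω → ℝ := fun ω => -∑ i, η i * f i ω with hFdef
  have hFexp : Integrable (fun ω => exp (F ω)) P := by simpa [hg] using hgint
  have htilt : Qstar = P.tilted F := by rw [hQstar, hZ, hg]; rfl
  subst htilt
  have hF {Q : Measure Ω} (hQ : ∀ i, Integrable (f i) Q) : Integrable F Q :=
    (integrable_finsetSum _ fun i _ => (hQ i).const_mul (η i)).neg
  have hFint {Q : Measure Ω} (hQ : ∀ i, Integrable (f i) Q) :
      ∫ ω, F ω ∂Q = -∑ i, η i * ∫ ω, f i ω ∂Q := by
    simp only [hFdef, integral_neg]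
    rw [integral_finsetSum _ fun i _ => (hQ i).const_mul (η i)]
    simp only [integral_const_mul]
  refine ⟨isProbabilityMeasure_tilted hFexp, fun Q _ _ hfQ heq => ?_⟩
  refine klDiv_tilted_le_and_eq_of_eq hFexp (hF hfQstar) (hF hfQ) ?_
  simp only [hFint hfQ, hFint hfQstar, heq]
end

section
/- Let P be a probability measure on a measurable space Ω, let f₁,…,f_n : Ω → ℝ be measurable, let η₁,…,η_n ∈ ℝ, set g := exp(−∑ᵢ ηᵢ fᵢ), assume 0 < Z := ∫ g dP < ∞, and let Q* := P.withDensity(g/Z). Assume each fᵢ is Q*-integrable. Then for every probability measure Q on Ω with Q ≪ P such that each fᵢ is Q-integrable and ∫ fᵢ dQ = ∫ fᵢ dQ* for all i = 1,…,n, the Pythagorean identity klDiv(Q ∥ P) = klDiv(Q ∥ Q*) + klDiv(Q* ∥ P) holds in [0,∞]. -/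
open MeasureTheory Real
open scoped ENNReal Classical

/-- Gibbs' inequality for probability measures. -/
lemma integral_llr_nonneg {Ω : Type*} [MeasurableSpace Ω] {Q P : Measure Ω}
    [IsProbabilityMeasure Q] [IsProbabilityMeasure P] (h : Q ≪ P)
    (h_int : Integrable (llr Q P) Q) : 0 ≤ ∫ ω, llr Q P ω ∂Q := by
  simpa using InformationTheory.integral_llr_add_sub_measure_univ_nonneg h h_int

/-- The Pythagorean identity for an exponential tilt `P.tilted F`. -/
theorem klDiv_eq_klDiv_tilted_add {Ω : Type*} [MeasurableSpace Ω] {P Q : Measure Ω}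
    [IsProbabilityMeasure P] [IsProbabilityMeasure Q] {F : Ω → ℝ}
    (hexp : Integrable (fun ω => exp (F ω)) P) (hQP : Q ≪ P) (hFQ : Integrable F Q)
    (hFT : Integrable F (P.tilted F)) (hF : ∫ ω, F ω ∂Q = ∫ ω, F ω ∂(P.tilted F)) :
    klDiv Q P = klDiv Q (P.tilted F) + klDiv (P.tilted F) P := by
  have : IsProbabilityMeasure (P.tilted F) := isProbabilityMeasure_tilted hexp
  have hTP : P.tilted F ≪ P := tilted_absolutelyContinuous P F
  have hQT : Q ≪ P.tilted F := hQP.trans (absolutelyContinuous_tilted hexp)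
  have hT : llr (P.tilted F) P =ᵐ[P.tilted F] fun ω => F ω - log (∫ x, exp (F x) ∂P) :=
    hTP.ae_le (log_rnDeriv_tilted_left_self hexp)
  have hT_int : Integrable (llr (P.tilted F) P) (P.tilted F) :=
    (integrable_congr hT).2 (hFT.sub (integrable_const _))
  have hT_eq : ∫ ω, llr (P.tilted F) P ω ∂(P.tilted F)
      = ∫ ω, F ω ∂Q - log (∫ x, exp (F x) ∂P) := by
    rw [integral_congr_ae hT, integral_sub hFT (integrable_const _), hF]
    simp
  by_cases hQ : Integrable (llr Q P) Q
  · have hQ' := integrable_llr_tilted_right hQP hFQ hQ hexp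
    rw [klDiv, klDiv, klDiv, if_pos ⟨hQP, hQ⟩, if_pos ⟨hQT, hQ'⟩, if_pos ⟨hTP, hT_int⟩,
      ← ENNReal.ofReal_add (integral_llr_nonneg hQT hQ') (integral_llr_nonneg hTP hT_int),
      hT_eq, integral_llr_tilted_right hQP hFQ hexp hQ]
    congr 1
    ring
  · have hQ' : ¬ Integrable (llr Q (P.tilted F)) Q := by
      rw [integrable_congr (llr_tilted_right hQP hexp)]
      exact fun h => hQ ((integrable_add_iff_integrable_right'
        (hFQ.neg.add (integrable_const _))).1 h)
    rw [klDiv, klDiv, if_neg fun h => hQ h.2, if_neg fun h => hQ' h.2, top_add]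

/-- the Pythagorean identity for KL divergence with respect to the
exponentially tilted measure `Q* = P.withDensity (g/Z)`, `g = exp(-∑ ηᵢ fᵢ)`:
for every probability measure `Q ≪ P` matching the moments of `Q*`,
`klDiv (Q ∥ P) = klDiv (Q ∥ Q*) + klDiv (Q* ∥ P)` in `[0,∞]`. -/
theorem stmt_3 {Ω : Type*} [MeasurableSpace Ω] (P : Measure Ω) [IsProbabilityMeasure P]
    (n : ℕ) (f : Fin n → Ω → ℝ) (hf : ∀ i, Measurable (f i)) (η : Fin n → ℝ)
    (g : Ω → ℝ) (hg : g = fun ω => exp (-∑ i, η i * f i ω))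
    (Z : ℝ) (hZ : Z = ∫ ω, g ω ∂P) (hgint : Integrable g P) (hZpos : 0 < Z)
    (Qstar : Measure Ω)
    (hQstar : Qstar = P.withDensity (fun ω => ENNReal.ofReal (g ω / Z)))
    (hfQstar : ∀ i, Integrable (f i) Qstar) :
    ∀ Q : Measure Ω, IsProbabilityMeasure Q → Q ≪ P →
      (∀ i, Integrable (f i) Q) →
      (∀ i, ∫ ω, f i ω ∂Q = ∫ ω, f i ω ∂Qstar) →
      klDiv Q P = klDiv Q Qstar + klDiv Qstar P := by
  subst hg hZ
  intro Q _ hQP hfQ hmom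
  have hQstar' : Qstar = P.tilted (fun ω => -∑ i, η i * f i ω) := hQstar
  rw [hQstar'] at hfQstar hmom ⊢
  have integrable_exponent {μ : Measure Ω} (h : ∀ i, Integrable (f i) μ) :
      Integrable (fun ω => -∑ i, η i * f i ω) μ :=
    (integrable_finsetSum _ fun i _ => (h i).const_mul (η i)).neg
  have integral_exponent {μ : Measure Ω} (h : ∀ i, Integrable (f i) μ) :
      ∫ ω, -∑ i, η i * f i ω ∂μ = -∑ i, η i * ∫ ω, f i ω ∂μ := by
    rw [integral_neg, integral_finsetSum _ fun i _ => (h i).const_mul (η i)]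
    simp_rw [integral_const_mul]
  refine klDiv_eq_klDiv_tilted_add hgint hQP (integrable_exponent hfQ)
    (integrable_exponent hfQstar) ?_
  rw [integral_exponent hfQ, integral_exponent hfQstar]
  simp_rw [hmom]
end

section
/- Let (Ω, 𝓕, P) be a probability space, Y : Ω → ℝ a random variable, q ∈ ℝ with 0 < P(Y < q) < 1, and α ∈ (0,1). Set η* := log( (1−α)·P(Y < q) / (α·P(Y ≥ q)) ), g := e^{−η*·1_{\{Y<q\}}}, and Q* := P.withDensity( g / E[g] ). Then Q* is a probability measure satisfying Q*(Y < q) = α. -/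
open MeasureTheory Real

/-- Normalising a nonnegative integrable function with positive integral gives a probability density. -/
lemma isProbabilityMeasure_withDensity_div_integral {Ω : Type*} [MeasurableSpace Ω]
    {P : Measure Ω} {g : Ω → ℝ} (hg : Integrable g P) (hg0 : 0 ≤ g) (hZ : 0 < ∫ ω, g ω ∂P) :
    IsProbabilityMeasure
      (P.withDensity fun ω => ENNReal.ofReal (g ω / ∫ ω', g ω' ∂P)) := by
  refine ⟨?_⟩
  rw [withDensity_apply _ .univ, setLIntegral_univ,
    ← ofReal_integral_eq_lintegral_ofReal (hg.div_const _)
    (.of_forall fun ω => div_nonneg (hg0 ω) hZ.le), integral_div, div_self hZ.ne',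
    ENNReal.ofReal_one]

/-- with `η* = log((1-α) P(Y<q) / (α P(Y≥q)))`, `g = e^{-η* 1_{Y<q}}`,
the tilted measure `Q* = P.withDensity (g / E[g])` is a probability measure with
`Q*(Y < q) = α`. -/
theorem stmt_6 {Ω : Type*} [MeasurableSpace Ω] (P : Measure Ω) [IsProbabilityMeasure P]
    (Y : Ω → ℝ) (hY : Measurable Y) (q : ℝ)
    (h0 : 0 < P {ω | Y ω < q}) (h1 : P {ω | Y ω < q} < 1)
    (α : ℝ) (hα : α ∈ Set.Ioo (0 : ℝ) 1)
    (ηstar : ℝ)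
    (hηstar : ηstar =
      log ((1 - α) * (P {ω | Y ω < q}).toReal / (α * (P {ω | q ≤ Y ω}).toReal)))
    (g : Ω → ℝ) (hg : g = fun ω => exp (-ηstar * (if Y ω < q then (1:ℝ) else 0)))
    (Qstar : Measure Ω)
    (hQstar : Qstar = P.withDensity fun ω => ENNReal.ofReal (g ω / ∫ ω', g ω' ∂P)) :
    IsProbabilityMeasure Qstar ∧ Qstar {ω | Y ω < q} = ENNReal.ofReal α := by
  obtain ⟨hα0, hα1⟩ := hα
  set A : Set Ω := {ω | Y ω < q}
  have hA : MeasurableSet A := measurableSet_lt hY measurable_const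
  have hAc : {ω | q ≤ Y ω} = Aᶜ := by ext ω; simp [A]
  set p : ℝ := P.real A with hp
  have hp0 : 0 < p := ENNReal.toReal_pos h0.ne' (measure_ne_top P A)
  have hp1 : p < 1 := by
    simpa [p, Measure.real] using (ENNReal.toReal_lt_toReal (measure_ne_top P A) ENNReal.one_ne_top).2 h1
  have hq : 0 < 1 - p := by linarith
  have hβ : 0 < 1 - α := by linarith
  set c : ℝ := exp (-ηstar)
  have hc : c = α * (1 - p) / ((1 - α) * p) := by
    have hη : ηstar = log ((1 - α) * p / (α * (1 - p))) := by
      rw [hηstar, hAc, hp, ← probReal_compl_eq_one_sub hA]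
      rfl
    simp only [c]
    rw [hη, exp_neg, exp_log (by positivity), inv_div]
  have hgA : g = fun ω => A.indicator (fun _ => c - 1) ω + 1 := by
    subst hg
    funext ω
    by_cases h : Y ω < q <;> simp [A, c, h]
  have hind : Integrable (A.indicator fun _ => c - 1) P :=
    (integrable_const _).indicator hA
  have hgi : Integrable g P := hgA ▸ hind.add (integrable_const 1)
  have hZ : ∫ ω, g ω ∂P = (1 - p) / (1 - α) := by
    rw [hgA, integral_add hind (integrable_const 1), integral_indicator_const _ hA, hc]
    simp only [integral_const, probReal_univ, smul_eq_mul, ← hp]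
    field_simp
    ring
  have hZ0 : 0 < ∫ ω, g ω ∂P := by rw [hZ]; positivity
  refine ⟨hQstar ▸ isProbabilityMeasure_withDensity_div_integral hgi
    (fun ω => hg ▸ (exp_pos _).le) hZ0, ?_⟩
  have hgc : ∀ ω ∈ A, ENNReal.ofReal (g ω / ∫ ω', g ω' ∂P)
      = ENNReal.ofReal (c / ∫ ω', g ω' ∂P) := fun ω hω => by
    have : g ω = c := by rw [hgA]; simp [hω]
    rw [this]
  rw [hQstar, withDensity_apply _ hA, setLIntegral_congr_fun hA hgc, setLIntegral_const,
    ← ofReal_measureReal (s := A), ← ENNReal.ofReal_mul (by positivity), hZ, hc, ← hp]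
  congr 1
  field_simp
end

section
/- Fix κ > 0 and a probability measure G on ℝ with G((−∞,0]) = 0, and for s ≥ 0 let μ_s := cp(κs, G). Fix η ∈ ℝ and q ∈ ℝ, and for s > 0 and x, y ∈ ℝ define F(s,x,y) := (1 + (e^{−η} − 1)·μ_s({z : z < q − x − y})) / (1 + (e^{−η} − 1)·μ_s({z : z < q − x})) (the denominator is strictly positive). Then: (i) if x > q, then F(s,x,y) = 1 for all s > 0 and all y ≥ 0; (ii) if x < q and y > 0, then lim_{s→0⁺} F(s,x,y) = 1 when x < q − y, and lim_{s→0⁺} F(s,x,y) = e^{η} when x ≥ q − y. -/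
open MeasureTheory Real Filter Topology

/-- `n`-fold convolution power of a measure on `ℝ` (`G^⋆0 = δ₀`). -/
noncomputable def convPow (G : Measure ℝ) : ℕ → Measure ℝ
  | 0 => Measure.dirac 0
  | n + 1 => (convPow G n).conv G

/-- The compound Poisson distribution `cp(λ, G) = ∑ₙ e^{-λ} λⁿ/n! • G^⋆n`. -/
noncomputable def cp (lam : ℝ) (G : Measure ℝ) : Measure ℝ :=
  Measure.sum fun n => (ENNReal.ofReal (exp (-lam) * lam ^ n / n.factorial)) • convPow G n

instance convPow.instIsProbabilityMeasure (G : Measure ℝ) [IsProbabilityMeasure G] (n : ℕ) :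
    IsProbabilityMeasure (convPow G n) := by
  induction n with
  | zero => unfold convPow; infer_instance
  | succ n ih => unfold convPow; infer_instance

theorem convPow_ae_nonneg (G : Measure ℝ) [IsProbabilityMeasure G] (hG : ∀ᵐ z ∂G, 0 ≤ z)
    (n : ℕ) : ∀ᵐ z ∂convPow G n, 0 ≤ z := by
  induction n with
  | zero => simp [convPow, ae_dirac_eq]
  | succ n ih =>
    rw [convPow, Measure.conv, ae_map_iff (by fun_prop) measurableSet_Ici]
    filter_upwards [Measure.quasiMeasurePreserving_fst.ae ih,
      Measure.quasiMeasurePreserving_snd.ae hG] with p h₁ h₂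
    exact add_nonneg h₁ h₂

theorem cp_Iio_eq_zero (lam : ℝ) (G : Measure ℝ) [IsProbabilityMeasure G]
    (hG : ∀ᵐ z ∂G, 0 ≤ z) {c : ℝ} (hc : c ≤ 0) : cp lam G (Set.Iio c) = 0 := by
  rw [cp, Measure.sum_apply _ measurableSet_Iio, ENNReal.tsum_eq_zero]
  intro n
  have h : convPow G n (Set.Iio c) = 0 :=
    measure_mono_null (fun z (hz : z < c) => not_le.2 (hz.trans_le hc)) (convPow_ae_nonneg G hG n)
  simp [h]

theorem isProbabilityMeasure_cp {lam : ℝ} (hlam : 0 ≤ lam) (G : Measure ℝ)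
    [IsProbabilityMeasure G] : IsProbabilityMeasure (cp lam G) := by
  have h : HasSum (fun n : ℕ => exp (-lam) * lam ^ n / n.factorial) 1 := by
    have := (NormedSpace.expSeries_div_hasSum_exp (𝔸 := ℝ) lam).mul_left (exp (-lam))
    rw [← Real.exp_eq_exp_ℝ, ← Real.exp_add] at this
    simpa [mul_div_assoc] using this
  constructor
  rw [cp, Measure.sum_apply _ MeasurableSet.univ]
  simp only [Measure.smul_apply, measure_univ, smul_eq_mul, mul_one]
  rw [← ENNReal.ofReal_tsum_of_nonneg (fun n => by positivity) h.summable, h.tsum_eq,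
    ENNReal.ofReal_one]

theorem ofReal_exp_neg_le_cp (lam : ℝ) (G : Measure ℝ) {A : Set ℝ} (hA : (0 : ℝ) ∈ A) :
    ENNReal.ofReal (exp (-lam)) ≤ cp lam G A := by
  refine le_trans ?_ (Measure.le_sum _ 0 A)
  simp [convPow, Measure.dirac_apply_of_mem hA]

theorem tendsto_cp_of_zero_mem {κ : ℝ} (hκ : 0 < κ) (G : Measure ℝ) [IsProbabilityMeasure G]
    {A : Set ℝ} (hA : (0 : ℝ) ∈ A) :
    Tendsto (fun s => (cp (κ * s) G A).toReal) (𝓝[>] (0 : ℝ)) (𝓝 1) := by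
  have h : Tendsto (fun s => exp (-(κ * s))) (𝓝[>] (0 : ℝ)) (𝓝 1) := by
    have : Continuous fun s : ℝ => exp (-(κ * s)) := by fun_prop
    simpa using (this.tendsto 0).mono_left nhdsWithin_le_nhds
  refine tendsto_of_tendsto_of_tendsto_of_le_of_le' h tendsto_const_nhds ?_ ?_ <;>
    filter_upwards [self_mem_nhdsWithin] with s (hs : 0 < s) <;>
    have := isProbabilityMeasure_cp (mul_pos hκ hs).le G
  · exact (ENNReal.ofReal_le_iff_le_toReal (measure_ne_top _ _)).1
      (ofReal_exp_neg_le_cp (κ * s) G hA)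
  · exact measureReal_le_one

/-- behaviour of the Girsanov kernel
`F(s,x,y) = (1 + (e^{-η}-1) μ_s(-∞, q-x-y)) / (1 + (e^{-η}-1) μ_s(-∞, q-x))`
with `μ_s = cp(κs, G)`: it equals `1` for `x > q`, and for `x < q`, `y > 0` its limit
as `s → 0⁺` is `1` if `x < q - y` and `e^η` if `x ≥ q - y`. -/
theorem stmt_7 (κ : ℝ) (hκ : 0 < κ) (G : Measure ℝ) [IsProbabilityMeasure G]
    (hG : G (Set.Iic 0) = 0) (η q : ℝ)
    (F : ℝ → ℝ → ℝ → ℝ)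
    (hF : F = fun s x y =>
      (1 + (exp (-η) - 1) * ((cp (κ * s) G) {z | z < q - x - y}).toReal) /
      (1 + (exp (-η) - 1) * ((cp (κ * s) G) {z | z < q - x}).toReal)) :
    (∀ x > q, ∀ s > (0:ℝ), ∀ y ≥ (0:ℝ), F s x y = 1) ∧
    (∀ x < q, ∀ y > (0:ℝ),
      (x < q - y →
        Tendsto (fun s => F s x y) (𝓝[>] (0:ℝ)) (𝓝 1)) ∧
      (q - y ≤ x →
        Tendsto (fun s => F s x y) (𝓝[>] (0:ℝ)) (𝓝 (exp η)))) := by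
  have hpos : ∀ᵐ z ∂G, 0 ≤ z :=
    measure_mono_null (fun z (hz : ¬ 0 ≤ z) => (not_le.1 hz).le) hG
  subst hF
  have hzero (s : ℝ) {c : ℝ} (hc : c ≤ 0) : cp (κ * s) G {z | z < c} = 0 :=
    cp_Iio_eq_zero (κ * s) G hpos hc
  have hlim {c : ℝ} (hc : 0 < c) :
      Tendsto (fun s => 1 + (exp (-η) - 1) * (cp (κ * s) G {z | z < c}).toReal)
        (𝓝[>] (0 : ℝ)) (𝓝 (exp (-η))) := by
    simpa using ((tendsto_cp_of_zero_mem hκ G (A := {z | z < c}) hc).const_mul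
      (exp (-η) - 1)).const_add 1
  refine ⟨fun x hx s _ y hy => ?_, fun x hx y _ => ⟨fun hxy => ?_, fun hxy => ?_⟩⟩
  · simp [hzero s (show q - x - y ≤ 0 by linarith), hzero s (show q - x ≤ 0 by linarith)]
  · have h := (hlim (show 0 < q - x - y by linarith)).div
      (hlim (show 0 < q - x by linarith)) (exp_pos _).ne'
    rwa [div_self (exp_pos _).ne'] at h
  · have h := (hlim (show 0 < q - x by linarith)).inv₀ (exp_pos _).ne'
    simpa [hzero _ (show q - x - y ≤ 0 by linarith), exp_neg] using h
end

section
/- Fix κ > 0 and a probability measure G on ℝ with G((−∞,0]) = 0, and for s ≥ 0 let μ_s := cp(κs, G). Fix η ∈ ℝ and q ∈ ℝ, and for s > 0 and x, y ∈ ℝ define F(s,x,y) := (1 + (e^{−η} − 1)·μ_s({z : z < q − x − y})) / (1 + (e^{−η} − 1)·μ_s({z : z < q − x})), and define the stressed intensity κ*(s,x) := κ·∫ F(s,x,y) dG(y). Then: (i) if x > q, then κ*(s,x) = κ for all s > 0; (ii) if x < q, then lim_{s→0⁺} κ*(s,x) = κ·( e^{η} + (1 − e^{η})·G({y : y < q −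 x}) ). -/
open MeasureTheory Real Filter Topology

instance isProbabilityMeasure_convPow (G : Measure ℝ) [IsProbabilityMeasure G] (n : ℕ) :
    IsProbabilityMeasure (convPow G n) := by
  induction n with
  | zero => exact Measure.dirac.isProbabilityMeasure
  | succ n ih => rw [convPow]; infer_instance

theorem conv_Iio_zero {μ ν : Measure ℝ} [SFinite μ] [SFinite ν]
    (hμ : μ (Set.Iio 0) = 0) (hν : ν (Set.Iio 0) = 0) : (μ.conv ν) (Set.Iio 0) = 0 := by
  rw [Measure.conv, Measure.map_apply (by fun_prop) measurableSet_Iio]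
  refine measure_mono_null
    (t := (Set.Iio 0 ×ˢ Set.univ) ∪ (Set.univ ×ˢ Set.Iio 0)) ?_ ?_
  · rintro ⟨a, b⟩ h
    simp only [Set.mem_preimage, Set.mem_Iio] at h
    simp only [Set.mem_union, Set.mem_prod, Set.mem_Iio, Set.mem_univ, and_true, true_and]
    by_contra! h'
    linarith [h'.1, h'.2]
  · simp [measure_union_null_iff, Measure.prod_prod, hμ, hν]

theorem convPow_Iio_zero {G : Measure ℝ} [IsProbabilityMeasure G]
    (hG : G (Set.Iio 0) = 0) (n : ℕ) : convPow G n (Set.Iio 0) = 0 := by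
  induction n with
  | zero => simp [convPow]
  | succ n ih => exact conv_Iio_zero ih hG

theorem cp_Iio_zero (lam : ℝ) {G : Measure ℝ} [IsProbabilityMeasure G]
    (hG : G (Set.Iio 0) = 0) : cp lam G (Set.Iio 0) = 0 := by
  rw [cp, Measure.sum_apply _ measurableSet_Iio]
  simp [convPow_Iio_zero hG]

/-- The atom of a compound Poisson distribution at `0` has mass at least `e^{-λ}`. -/
theorem exp_neg_le_cp_real_of_mem {lam : ℝ} (hlam : 0 ≤ lam) (G : Measure ℝ)
    [IsProbabilityMeasure G] {A : Set ℝ} (h0 : (0 : ℝ) ∈ A) :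
    exp (-lam) ≤ (cp lam G A).toReal := by
  have := isProbabilityMeasure_cp hlam G
  rw [← ENNReal.ofReal_le_iff_le_toReal (measure_ne_top _ _)]
  refine le_trans ?_ (Measure.le_sum (fun n : ℕ =>
    ENNReal.ofReal (exp (-lam) * lam ^ n / n.factorial) • convPow G n) 0 A)
  simp [convPow, h0]

/-- As `s → 0⁺`, `cp(κs, G)` converges setwise to `δ₀`. -/
theorem tendsto_cp_real {κ : ℝ} (hκ : 0 < κ) (G : Measure ℝ) [IsProbabilityMeasure G]
    {A : Set ℝ} (hA : MeasurableSet A) :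
    Tendsto (fun s => (cp (κ * s) G A).toReal) (𝓝[>] (0 : ℝ))
      (𝓝 (A.indicator (fun _ => (1 : ℝ)) 0)) := by
  have hexp : Tendsto (fun s : ℝ => exp (-(κ * s))) (𝓝[>] (0 : ℝ)) (𝓝 1) := by
    have : Continuous fun s : ℝ => exp (-(κ * s)) := by fun_prop
    simpa using (this.tendsto 0).mono_left nhdsWithin_le_nhds
  have key : ∀ B : Set ℝ, (0 : ℝ) ∈ B →
      Tendsto (fun s => (cp (κ * s) G B).toReal) (𝓝[>] (0 : ℝ)) (𝓝 1) := by
    intro B hB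
    refine tendsto_of_tendsto_of_tendsto_of_le_of_le' hexp tendsto_const_nhds ?_ ?_
    · filter_upwards [self_mem_nhdsWithin] with s hs
      exact exp_neg_le_cp_real_of_mem (mul_pos hκ hs).le G hB
    · filter_upwards [self_mem_nhdsWithin] with s hs
      have := isProbabilityMeasure_cp (mul_pos hκ hs).le G
      exact measureReal_le_one
  by_cases h0 : (0 : ℝ) ∈ A
  · simpa [h0] using key A h0
  · have h := (key Aᶜ h0).const_sub 1
    rw [Set.indicator_of_notMem h0]
    rw [sub_self] at h
    refine h.congr' ?_
    filter_upwards [self_mem_nhdsWithin] with s hs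
    have := isProbabilityMeasure_cp (mul_pos hκ hs).le G
    have := probReal_compl_eq_one_sub (μ := cp (κ * s) G) hA
    simp only [Measure.real] at this
    rw [this]; ring

/-- the stressed intensity `κ*(s,x) = κ ∫ F(s,x,y) dG(y)` equals `κ` for
`x > q`, and for `x < q` it tends, as `s → 0⁺`, to
`κ (e^η + (1 - e^η) G(-∞, q-x))`. -/
theorem stmt_8 (κ : ℝ) (hκ : 0 < κ) (G : Measure ℝ) [IsProbabilityMeasure G]
    (hG : G (Set.Iic 0) = 0) (η q : ℝ)
    (F : ℝ → ℝ → ℝ → ℝ)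
    (hF : F = fun s x y =>
      (1 + (exp (-η) - 1) * ((cp (κ * s) G) {z | z < q - x - y}).toReal) /
      (1 + (exp (-η) - 1) * ((cp (κ * s) G) {z | z < q - x}).toReal))
    (κstar : ℝ → ℝ → ℝ)
    (hκstar : κstar = fun s x => κ * ∫ y, F s x y ∂G) :
    (∀ x > q, ∀ s > (0:ℝ), κstar s x = κ) ∧
    (∀ x < q,
      Tendsto (fun s => κstar s x) (𝓝[>] (0:ℝ))
        (𝓝 (κ * (exp η + (1 - exp η) * (G {y | y < q - x}).toReal)))) := by
  subst hF hκstar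
  have hG0 : G (Set.Iio 0) = 0 := measure_mono_null Set.Iio_subset_Iic_self hG
  refine ⟨fun x hx s _ => ?_, fun x hx => ?_⟩
  · have hnull : ∀ c ≤ (0 : ℝ), cp (κ * s) G {z | z < c} = 0 := fun c hc =>
      measure_mono_null (fun z hz => lt_of_lt_of_le hz hc) (cp_Iio_zero (κ * s) hG0)
    have hae : ∀ᵐ y ∂G, (1 + (exp (-η) - 1) * ((cp (κ * s) G) {z | z < q - x - y}).toReal) /
        (1 + (exp (-η) - 1) * ((cp (κ * s) G) {z | z < q - x}).toReal) = 1 := by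
      have hpos : ∀ᵐ y ∂G, y ∉ Set.Iic (0 : ℝ) := measure_eq_zero_iff_ae_notMem.1 hG
      filter_upwards [hpos] with y hy
      rw [Set.mem_Iic, not_le] at hy
      rw [hnull _ (by linarith), hnull _ (by linarith)]
      simp
    simp only [integral_congr_ae hae]
    simp
  · refine Tendsto.const_mul κ ?_
    simp only [integral_div]
    have hden := ((tendsto_cp_real hκ G (measurableSet_Iio (a := q - x))).const_mul
      (exp (-η) - 1)).const_add 1
    rw [Set.indicator_of_mem (by simpa using hx)] at hden
    have hnum : Tendsto
        (fun s => ∫ y, (1 + (exp (-η) - 1) * ((cp (κ * s) G) {z | z < q - x - y}).toReal) ∂G)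
        (𝓝[>] (0 : ℝ))
        (𝓝 (∫ y, (1 + (exp (-η) - 1) * {y | y < q - x}.indicator (fun _ => (1 : ℝ)) y) ∂G)) := by
      refine tendsto_integral_filter_of_dominated_convergence
        (fun _ => 1 + |exp (-η) - 1|) ?_ ?_ (integrable_const _) ?_
      · filter_upwards [self_mem_nhdsWithin] with s hs
        have := isProbabilityMeasure_cp (mul_pos hκ hs).le G
        have hanti : Antitone fun y => ((cp (κ * s) G) {z | z < q - x - y}).toReal :=
          fun a b hab => measureReal_mono fun z (hz : z < q - x - b) =>
            show z < q - x - a by linarith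
        exact ((hanti.measurable.const_mul _).const_add _).aestronglyMeasurable
      · filter_upwards [self_mem_nhdsWithin] with s hs
        have := isProbabilityMeasure_cp (mul_pos hκ hs).le G
        refine ae_of_all _ fun y => ?_
        have h1 : ((cp (κ * s) G) {z | z < q - x - y}).toReal ≤ 1 := measureReal_le_one
        refine (norm_add_le _ _).trans ?_
        rw [norm_one, norm_mul, Real.norm_eq_abs, Real.norm_of_nonneg ENNReal.toReal_nonneg]
        gcongr
        exact mul_le_of_le_one_right (abs_nonneg _) h1
      · refine ae_of_all _ fun y => ?_
        have h := ((tendsto_cp_real hκ G (measurableSet_Iio (a := q - x - y))).const_mul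
          (exp (-η) - 1)).const_add 1
        have heq : {y | y < q - x}.indicator (fun _ => (1 : ℝ)) y =
            (Set.Iio (q - x - y)).indicator (fun _ => (1 : ℝ)) 0 := by
          simp only [Set.indicator_apply, Set.mem_ofPred_eq, Set.mem_Iio, sub_pos]
        rw [heq]
        exact h
    have hms : MeasurableSet {y | y < q - x} := measurableSet_Iio
    rw [integral_add (integrable_const _)
      (((integrable_const _).indicator hms).const_mul _), integral_const_mul,
      integral_indicator_const _ hms] at hnum
    have h := hnum.div hden (by simp [(exp_pos (-η)).ne'])
    convert h using 2
    · rfl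
    simp only [integral_const, smul_eq_mul, mul_one, Measure.real, measure_univ, ENNReal.toReal_one]
    rw [add_sub_cancel, exp_neg]
    field_simp
end

section
/- Let (Ω, 𝓕, P) be a probability space, Y : Ω → ℝ a random variable, and q ∈ ℝ with P(Y > q) > 0. Let P_q denote the conditional probability measure P(· | {Y > q}), and assume ∫ e^{tY} dP_q < ∞ for every t ∈ ℝ. Then for every real s with essInf_{P_q} Y < s < essSup_{P_q} Y (the essential infimum and supremum of Y under P_q, the latter possibly +∞), there exists a unique η₂ ∈ ℝ such that E_P[ e^{−η₂(Y−q)}·(Y − s)·1_{\{Y>q\}} ] = 0. -/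
open MeasureTheory ProbabilityTheory Real

section TiltedIntegral

variable {Ω : Type*} [MeasurableSpace Ω] {μ : Measure Ω} {X : Ω → ℝ}

lemma integrable_pow_mul_exp_of_forall (h : ∀ t : ℝ, Integrable (fun ω => exp (t * X ω)) μ)
    (t : ℝ) (n : ℕ) : Integrable (fun ω => X ω ^ n * exp (t * X ω)) μ := by
  refine integrable_pow_mul_exp_of_mem_interior_integrableExpSet ?_ n
  have : integrableExpSet X μ = Set.univ := Set.eq_univ_of_forall h
  simp [this]

lemma integrable_exp_mul_self_of_forall (h : ∀ t : ℝ, Integrable (fun ω => exp (t * X ω)) μ)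
    (t : ℝ) : Integrable (fun ω => exp (t * X ω) * X ω) μ := by
  simpa [mul_comm] using integrable_pow_mul_exp_of_forall h t 1

lemma continuous_integral_exp_mul_self
    (h : ∀ t : ℝ, Integrable (fun ω => exp (t * X ω)) μ) :
    Continuous (fun t : ℝ => ∫ ω, exp (t * X ω) * X ω ∂μ) := by
  have hset : integrableExpSet X μ = Set.univ := Set.eq_univ_of_forall h
  have hderiv : (fun t : ℝ => ∫ ω, exp (t * X ω) * X ω ∂μ) = deriv (mgf X μ) := by
    funext t
    rw [deriv_mgf (by simp [hset])]
    simp_rw [mul_comm]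
  rw [hderiv, continuous_iff_continuousAt]
  exact fun t => (analyticAt_mgf (by simp [hset])).deriv.continuousAt

lemma exp_mul_sub_exp_mul_mul_self_pos {t u x : ℝ} (htu : t < u) (hx : x ≠ 0) :
    0 < exp (u * x) * x - exp (t * x) * x := by
  rcases hx.lt_or_gt with hx | hx
  · have : exp (u * x) < exp (t * x) := exp_lt_exp.2 (by nlinarith)
    nlinarith
  · have : exp (t * x) < exp (u * x) := exp_lt_exp.2 (by nlinarith)
    nlinarith

lemma strictMono_integral_exp_mul_self
    (h : ∀ t : ℝ, Integrable (fun ω => exp (t * X ω)) μ) (hpos : μ {ω | 0 < X ω} ≠ 0) :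
    StrictMono (fun t : ℝ => ∫ ω, exp (t * X ω) * X ω ∂μ) := by
  intro t u htu
  have ht := integrable_exp_mul_self_of_forall h t
  have hu := integrable_exp_mul_self_of_forall h u
  rw [← sub_pos, ← integral_sub hu ht, integral_pos_iff_support_of_nonneg _ (by exact hu.sub ht)]
  · refine (pos_iff_ne_zero.2 hpos).trans_le (measure_mono fun ω hω => ?_)
    exact (exp_mul_sub_exp_mul_mul_self_pos htu (ne_of_gt hω)).ne'
  · intro ω
    by_cases hx : X ω = 0
    · simp [hx]
    · exact (exp_mul_sub_exp_mul_mul_self_pos htu hx).le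

lemma min_zero_add_mul_sq_le_exp_mul_self {t : ℝ} (ht : 0 ≤ t) (x : ℝ) :
    min x 0 + t * max x 0 ^ 2 ≤ exp (t * x) * x := by
  rcases le_total x 0 with hx | hx
  · rw [min_eq_left hx, max_eq_right hx]
    have : exp (t * x) ≤ 1 := exp_le_one_iff.2 (mul_nonpos_of_nonneg_of_nonpos ht hx)
    nlinarith
  · rw [min_eq_right hx, max_eq_left hx]
    nlinarith [mul_le_mul_of_nonneg_right (add_one_le_exp (t * x)) hx]

lemma exists_integral_exp_mul_self_pos
    (h : ∀ t : ℝ, Integrable (fun ω => exp (t * X ω)) μ) (hpos : μ {ω | 0 < X ω} ≠ 0) :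
    ∃ t : ℝ, 0 < ∫ ω, exp (t * X ω) * X ω ∂μ := by
  have hX : Integrable X μ := by simpa using integrable_pow_mul_exp_of_forall h 0 1
  have hX2 : Integrable (fun ω => X ω ^ 2) μ := by
    simpa using integrable_pow_mul_exp_of_forall h 0 2
  have hmin : Integrable (fun ω => min (X ω) 0) μ := hX.inf (integrable_zero _ _ _)
  have hmax : Integrable (fun ω => max (X ω) 0 ^ 2) μ := by
    refine hX2.mono' ((hX.sup (integrable_zero _ _ _)).aestronglyMeasurable.pow 2)
      (.of_forall fun ω => ?_)
    rw [norm_of_nonneg (sq_nonneg _)]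
    rcases le_total (X ω) 0 with hx | hx <;> simp [hx, sq_nonneg]
  have hb : 0 < ∫ ω, max (X ω) 0 ^ 2 ∂μ := by
    rw [integral_pos_iff_support_of_nonneg (fun ω => sq_nonneg _) hmax]
    refine (pos_iff_ne_zero.2 hpos).trans_le (measure_mono fun ω hω => ?_)
    exact (pow_pos (lt_max_of_lt_left hω) 2).ne'
  set a := ∫ ω, min (X ω) 0 ∂μ
  set b := ∫ ω, max (X ω) 0 ^ 2 ∂μ
  have ht : 0 ≤ (|a| + 1) / b := by positivity
  refine ⟨(|a| + 1) / b, ?_⟩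
  calc 0 < a + (|a| + 1) / b * b := by
        rw [div_mul_cancel₀ _ hb.ne']
        linarith [neg_abs_le a]
    _ = ∫ ω, (min (X ω) 0 + (|a| + 1) / b * max (X ω) 0 ^ 2) ∂μ := by
        rw [integral_add hmin (hmax.const_mul _), integral_const_mul]
    _ ≤ _ := integral_mono (hmin.add (hmax.const_mul _))
        (integrable_exp_mul_self_of_forall h _)
        fun ω => min_zero_add_mul_sq_le_exp_mul_self ht (X ω)

theorem existsUnique_integral_exp_mul_self_eq_zero
    (h : ∀ t : ℝ, Integrable (fun ω => exp (t * X ω)) μ)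
    (hpos : μ {ω | 0 < X ω} ≠ 0) (hneg : μ {ω | X ω < 0} ≠ 0) :
    ∃! t : ℝ, ∫ ω, exp (t * X ω) * X ω ∂μ = 0 := by
  have hmono := strictMono_integral_exp_mul_self h hpos
  obtain ⟨u, hu⟩ := exists_integral_exp_mul_self_pos h hpos
  obtain ⟨v, hv⟩ := exists_integral_exp_mul_self_pos (X := fun ω => -X ω)
    (fun t => by simpa using h (-t)) (by simpa using hneg)
  have hv' : ∫ ω, exp (-v * X ω) * X ω ∂μ < 0 := by
    simpa [integral_neg] using hv
  obtain ⟨t, ht⟩ := mem_range_of_exists_le_of_exists_ge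
    (continuous_integral_exp_mul_self h) ⟨-v, hv'.le⟩ ⟨u, hu.le⟩
  exact ⟨t, ht, fun r hr => hmono.injective (hr.trans ht.symm)⟩

end TiltedIntegral

lemma integral_exp_mul_sub_mul_indicator_eq {Ω : Type*} [MeasurableSpace Ω] (P : Measure Ω)
    [IsFiniteMeasure P] {Y : Ω → ℝ} (hY : Measurable Y) {q : ℝ} (hq : P {ω | q < Y ω} ≠ 0)
    (s η : ℝ) :
    ∫ ω, exp (-η * (Y ω - q)) * (Y ω - s) * (if q < Y ω then (1:ℝ) else 0) ∂P =
      P.real {ω | q < Y ω} * exp (-η * (s - q)) *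
        ∫ ω, exp (-η * (Y ω - s)) * (Y ω - s) ∂(P[|{ω | q < Y ω}]) := by
  have hA : MeasurableSet {ω | q < Y ω} := measurableSet_lt measurable_const hY
  have hPA : P.real {ω | q < Y ω} ≠ 0 := (measureReal_ne_zero_iff).2 hq
  have hint : ∀ ω, exp (-η * (Y ω - q)) * (Y ω - s) * (if q < Y ω then (1:ℝ) else 0) =
      {ω | q < Y ω}.indicator
        (fun ω => exp (-η * (s - q)) * (exp (-η * (Y ω - s)) * (Y ω - s))) ω := by
    intro ω
    rw [Set.indicator_apply, ← mul_assoc, ← exp_add]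
    simp only [Set.mem_ofPred_eq, mul_ite, mul_one, mul_zero]
    ring_nf
  simp_rw [hint]
  rw [integral_indicator hA, integral_const_mul, ProbabilityTheory.cond, integral_smul_measure,
    ENNReal.toReal_inv, smul_eq_mul]
  change _ = P.real _ * _ * ((P.real _)⁻¹ * _)
  field_simp

/-- under the conditional measure `P(·|Y>q)`, if all exponential moments
are finite, then for every `s` strictly between the essential infimum and essential
supremum of `Y` under `P(·|Y>q)` there is a unique `η₂` with
`E_P[e^{-η₂(Y-q)} (Y-s) 1_{Y>q}] = 0`. -/
theorem stmt_10 {Ω : Type*} [MeasurableSpace Ω] (P : Measure Ω) [IsProbabilityMeasure P]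
    (Y : Ω → ℝ) (hY : Measurable Y) (q : ℝ)
    (hq : 0 < P {ω | q < Y ω})
    (hmgf : ∀ t : ℝ, Integrable (fun ω => exp (t * Y ω)) (P[|{ω | q < Y ω}]))
    (s : ℝ)
    (hs1 : essInf (fun ω => (Y ω : EReal)) (P[|{ω | q < Y ω}]) < (s : EReal))
    (hs2 : (s : EReal) < essSup (fun ω => (Y ω : EReal)) (P[|{ω | q < Y ω}])) :
    ∃! η₂ : ℝ,
      ∫ ω, exp (-η₂ * (Y ω - q)) * (Y ω - s) * (if q < Y ω then (1:ℝ) else 0) ∂P = 0 := by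
  set Q := P[|{ω | q < Y ω}]
  have hpos : Q {ω | 0 < Y ω - s} ≠ 0 := fun h0 => by
    refine hs2.not_ge (essSup_le_of_ae_le _ ?_)
    filter_upwards [measure_eq_zero_iff_ae_notMem.1 h0] with ω hω
    simpa using hω
  have hneg : Q {ω | Y ω - s < 0} ≠ 0 := fun h0 => by
    refine hs1.not_ge (le_essInf_of_ae_le _ ?_)
    filter_upwards [measure_eq_zero_iff_ae_notMem.1 h0] with ω hω
    simpa using hω
  have hexp : ∀ t : ℝ, Integrable (fun ω => exp (t * (Y ω - s))) Q := fun t => by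
    simpa [mul_sub, exp_sub] using (hmgf t).div_const (exp (t * s))
  have hzero : ∀ η : ℝ,
      ∫ ω, exp (-η * (Y ω - q)) * (Y ω - s) * (if q < Y ω then (1:ℝ) else 0) ∂P = 0 ↔
        ∫ ω, exp (-η * (Y ω - s)) * (Y ω - s) ∂Q = 0 := fun η => by
    have hPA : P.real {ω | q < Y ω} ≠ 0 := (measureReal_ne_zero_iff).2 hq.ne'
    rw [integral_exp_mul_sub_mul_indicator_eq P hY hq.ne',
      mul_eq_zero_iff_left (mul_ne_zero hPA (exp_ne_zero _))]
  obtain ⟨t, ht, huniq⟩ := existsUnique_integral_exp_mul_self_eq_zero hexp hpos hneg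
  refine ⟨-t, (hzero _).2 (by simpa using ht), fun η hη => ?_⟩
  rw [← huniq (-η) ((hzero η).1 hη), neg_neg]
end

section
/- Let (Ω, 𝓕, P) be a probability space, Y : Ω → ℝ a random variable, q ∈ ℝ with P(Y < q) > 0 and P(Y ≥ q) > 0, and α ∈ (0,1). Let s ∈ ℝ and η₂ ∈ ℝ be such that B := E[ e^{−η₂(Y−q)}·1_{\{Y≥q\}} ] satisfies 0 < B < ∞, the function e^{−η₂(Y−q)}·|Y−q|·1_{\{Y≥q\}} is P-integrable, and E[ e^{−η₂(Y−q)}·(Y − s)·1_{\{Y≥q\}} ] = 0. Define η₁ := log( (1−α)·P(Y < q) / (α·B) ), g := e^{−η₁}·1_{\{Y<q\}} + e^{−η₂(Y−q)}·1_{\{Y≥q\}}, and Q := P.withDensity( g / E[g] ). Then Q is a probability measure satisfying Q(Y < q) = α and E_Q[ (Y − q)·1_{\{Y≥q\}} ] = (s − q)·(1 − α). -/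
open MeasureTheory Real

/-- with `η₂` solving the CVaR equation and
`η₁ = log((1-α) P(Y<q) / (α B))`, `B = E[e^{-η₂(Y-q)} 1_{Y≥q}]`, the measure
`Q = P.withDensity (g / E[g])` with `g = e^{-η₁} 1_{Y<q} + e^{-η₂(Y-q)} 1_{Y≥q}` is a
probability measure satisfying `Q(Y<q) = α` and `E_Q[(Y-q) 1_{Y≥q}] = (s-q)(1-α)`. -/
theorem stmt_11 {Ω : Type*} [MeasurableSpace Ω] (P : Measure Ω) [IsProbabilityMeasure P]
    (Y : Ω → ℝ) (hY : Measurable Y) (q : ℝ)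
    (h0 : 0 < P {ω | Y ω < q}) (h1 : 0 < P {ω | q ≤ Y ω})
    (α : ℝ) (hα : α ∈ Set.Ioo (0 : ℝ) 1) (s η₂ : ℝ)
    (B : ℝ)
    (hB : B = ∫ ω, exp (-η₂ * (Y ω - q)) * (if q ≤ Y ω then (1:ℝ) else 0) ∂P)
    (hBint : Integrable
      (fun ω => exp (-η₂ * (Y ω - q)) * (if q ≤ Y ω then (1:ℝ) else 0)) P)
    (hBpos : 0 < B)
    (habs : Integrable
      (fun ω => exp (-η₂ * (Y ω - q)) * |Y ω - q| * (if q ≤ Y ω then (1:ℝ) else 0)) P)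
    (hzero : ∫ ω, exp (-η₂ * (Y ω - q)) * (Y ω - s) * (if q ≤ Y ω then (1:ℝ) else 0) ∂P = 0)
    (η₁ : ℝ) (hη₁ : η₁ = log ((1 - α) * (P {ω | Y ω < q}).toReal / (α * B)))
    (g : Ω → ℝ)
    (hg : g = fun ω => exp (-η₁) * (if Y ω < q then (1:ℝ) else 0) +
      exp (-η₂ * (Y ω - q)) * (if q ≤ Y ω then (1:ℝ) else 0))
    (Q : Measure Ω)
    (hQ : Q = P.withDensity fun ω => ENNReal.ofReal (g ω / ∫ ω', g ω' ∂P)) :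
    IsProbabilityMeasure Q ∧
    Q {ω | Y ω < q} = ENNReal.ofReal α ∧
    ∫ ω, (Y ω - q) * (if q ≤ Y ω then (1:ℝ) else 0) ∂Q = (s - q) * (1 - α) := by
  obtain ⟨hα0, hα1⟩ := hα
  have hα2 : 0 < 1 - α := by linarith
  set p : ℝ := (P {ω | Y ω < q}).toReal with hp
  have hp0 : 0 < p := ENNReal.toReal_pos h0.ne' (measure_ne_top _ _)
  have hA : MeasurableSet {ω | Y ω < q} := measurableSet_lt hY measurable_const
  have hC : MeasurableSet {ω | q ≤ Y ω} := measurableSet_le measurable_const hY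
  have hc : exp (-η₁) = α * B / ((1 - α) * p) := by
    rw [exp_neg, hη₁, exp_log (by positivity), inv_div]
  have hind : (fun ω => if Y ω < q then (1:ℝ) else 0) = {ω | Y ω < q}.indicator 1 := by
    ext ω; simp [Set.indicator_apply]
  have hint_ind : Integrable (fun ω => if Y ω < q then (1:ℝ) else 0) P := by
    rw [hind]; exact (integrable_const (1:ℝ)).indicator hA
  have hval_ind : ∫ ω, (if Y ω < q then (1:ℝ) else 0) ∂P = p := by
    rw [hind, integral_indicator_one hA]; rfl
  have hgint : Integrable g P := by
    rw [hg]; exact (hint_ind.const_mul _).add hBint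
  have hgm : Measurable g := by
    rw [hg]
    exact (measurable_const.mul (Measurable.ite hA measurable_const measurable_const)).add
      (Measurable.mul (by fun_prop) (Measurable.ite hC measurable_const measurable_const))
  have hZ : ∫ ω, g ω ∂P = B / (1 - α) := by
    rw [hg, integral_add (hint_ind.const_mul _) hBint, integral_const_mul, hval_ind, ← hB, hc]
    field_simp
    ring
  rw [hZ] at hQ
  have hg0 : ∀ ω, 0 ≤ g ω := fun ω => by
    rw [hg]; dsimp only; split_ifs <;> positivity
  have hd0 : ∀ ω, 0 ≤ g ω / (B / (1 - α)) := fun ω => div_nonneg (hg0 ω) (by positivity)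
  have hdint : Integrable (fun ω => g ω / (B / (1 - α))) P := hgint.div_const _
  refine ⟨⟨?_⟩, ?_, ?_⟩
  · rw [hQ, withDensity_apply _ MeasurableSet.univ, Measure.restrict_univ,
      ← ofReal_integral_eq_lintegral_ofReal hdint (.of_forall hd0), integral_div, hZ,
      div_self (by positivity), ENNReal.ofReal_one]
  · rw [hQ, withDensity_apply _ hA,
      ← ofReal_integral_eq_lintegral_ofReal hdint.integrableOn (.of_forall hd0), integral_div]
    have hset : ∫ ω in {ω | Y ω < q}, g ω ∂P = p * exp (-η₁) := by
      rw [setIntegral_congr_fun (g := fun _ => exp (-η₁)) hA, setIntegral_const]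
      · rfl
      · intro ω hω
        have hω' : Y ω < q := hω
        simp [hg, hω', not_le.mpr hω']
    rw [hset, hc]
    congr 1
    field_simp
  · rw [hQ, integral_withDensity_eq_integral_toReal_smul (by fun_prop)
      (.of_forall fun _ => ENNReal.ofReal_lt_top)]
    have hlin : Integrable (fun ω => exp (-η₂ * (Y ω - q)) * (Y ω - s) *
        (if q ≤ Y ω then (1:ℝ) else 0)) P := by
      have hsub := habs.add (hBint.const_mul (q - s))
      refine hsub.congr (.of_forall fun ω => ?_)
      by_cases h : q ≤ Y ω
      · simp only [Pi.add_apply, h, if_true, abs_of_nonneg (sub_nonneg.mpr h)]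
        ring
      · simp [h]
    have hpt : ∀ ω, (ENNReal.ofReal (g ω / (B / (1 - α)))).toReal •
        ((Y ω - q) * (if q ≤ Y ω then (1:ℝ) else 0)) =
        (exp (-η₂ * (Y ω - q)) * (Y ω - s) * (if q ≤ Y ω then (1:ℝ) else 0) +
          (s - q) * (exp (-η₂ * (Y ω - q)) * (if q ≤ Y ω then (1:ℝ) else 0))) /
          (B / (1 - α)) := fun ω => by
      rw [ENNReal.toReal_ofReal (hd0 ω), smul_eq_mul]
      by_cases h : q ≤ Y ω
      · simp only [hg, h, not_lt.mpr h, if_true, if_false]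
        ring
      · simp [h]
    simp_rw [hpt]
    rw [integral_div, integral_add hlin (hBint.const_mul _), hzero, integral_const_mul, ← hB]
    field_simp
    ring
end

section
/- Let (Ω, 𝓕, P) be a probability space, Y : Ω → ℝ a random variable, q ∈ ℝ with P(Y > q) > 0, s ∈ ℝ, and η₂ ∈ ℝ. Assume the functions e^{−η₂(Y−q)}·|Y−s|·1_{\{Y>q\}} and |Y−s|·1_{\{Y>q\}} are P-integrable and that E[ e^{−η₂(Y−q)}·(Y − s)·1_{\{Y>q\}} ] = 0. Then: (i) if s < E[Y·1_{\{Y>q\}}]/P(Y > q), then η₂ > 0; (ii) if s > E[Y·1_{\{Y>q\}}]/P(Y > q), then η₂ < 0. -/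
open MeasureTheory Real

/-- Chebyshev-type pointwise inequality for an exponential weight with nonnegative exponent. -/
lemma exp_mul_sub_le_of_nonneg {a : ℝ} (ha : 0 ≤ a) (q s y : ℝ) :
    exp (a * (s - q)) * (y - s) ≤ exp (a * (y - q)) * (y - s) := by
  rcases le_total s y with h | h
  · exact mul_le_mul_of_nonneg_right (exp_le_exp.2 (by gcongr)) (sub_nonneg.2 h)
  · exact mul_le_mul_of_nonpos_right (exp_le_exp.2 (by gcongr)) (sub_nonpos.2 h)

/-- Chebyshev-type pointwise inequality for an exponential weight with nonpositive exponent. -/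
lemma exp_mul_sub_le_of_nonpos {a : ℝ} (ha : a ≤ 0) (q s y : ℝ) :
    exp (a * (y - q)) * (y - s) ≤ exp (a * (s - q)) * (y - s) := by
  rcases le_total s y with h | h
  · refine mul_le_mul_of_nonneg_right (exp_le_exp.2 ?_) (sub_nonneg.2 h)
    exact mul_le_mul_of_nonpos_left (by gcongr) ha
  · refine mul_le_mul_of_nonpos_right (exp_le_exp.2 ?_) (sub_nonpos.2 h)
    exact mul_le_mul_of_nonpos_left (by gcongr) ha

/-- sign of the Lagrange multiplier `η₂` solving
`E[e^{-η₂(Y-q)} (Y-s) 1_{Y>q}] = 0`: it is positive when `s` is below the conditional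
mean `E[Y 1_{Y>q}]/P(Y>q)` and negative when `s` is above it. -/
theorem stmt_12 {Ω : Type*} [MeasurableSpace Ω] (P : Measure Ω) [IsProbabilityMeasure P]
    (Y : Ω → ℝ) (hY : Measurable Y) (q : ℝ)
    (hq : 0 < P {ω | q < Y ω}) (s η₂ : ℝ)
    (hint1 : Integrable
      (fun ω => exp (-η₂ * (Y ω - q)) * |Y ω - s| * (if q < Y ω then (1:ℝ) else 0)) P)
    (hint2 : Integrable (fun ω => |Y ω - s| * (if q < Y ω then (1:ℝ) else 0)) P)
    (hzero : ∫ ω, exp (-η₂ * (Y ω - q)) * (Y ω - s) * (if q < Y ω then (1:ℝ) else 0) ∂P = 0) :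
    (s < (∫ ω, Y ω * (if q < Y ω then (1:ℝ) else 0) ∂P) / (P {ω | q < Y ω}).toReal →
      0 < η₂) ∧
    ((∫ ω, Y ω * (if q < Y ω then (1:ℝ) else 0) ∂P) / (P {ω | q < Y ω}).toReal < s →
      η₂ < 0) := by
  have hS : MeasurableSet {ω | q < Y ω} := measurableSet_lt measurable_const hY
  have h_ind : Measurable fun ω => if q < Y ω then (1 : ℝ) else 0 :=
    Measurable.ite hS measurable_const measurable_const
  have h_weighted : Integrable
      (fun ω => exp (-η₂ * (Y ω - q)) * (Y ω - s) * (if q < Y ω then (1:ℝ) else 0)) P := by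
    refine hint1.mono (by fun_prop) (ae_of_all _ fun ω => ?_)
    simp only [norm_mul, norm_eq_abs, abs_abs, le_refl]
  have h_centered : Integrable (fun ω => (Y ω - s) * (if q < Y ω then (1:ℝ) else 0)) P := by
    refine hint2.mono (by fun_prop) (ae_of_all _ fun ω => ?_)
    simp only [norm_mul, norm_eq_abs, abs_abs, le_refl]
  have h_ind_int : Integrable (fun ω => if q < Y ω then (1 : ℝ) else 0) P := by
    refine (integrable_const (1 : ℝ)).mono (by fun_prop) (ae_of_all _ fun ω => ?_)
    split_ifs <;> simp
  have h_mass : ∫ ω, (if q < Y ω then (1 : ℝ) else 0) ∂P = (P {ω | q < Y ω}).toReal :=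
    integral_indicator_one hS
  have h_mean : ∫ ω, Y ω * (if q < Y ω then (1:ℝ) else 0) ∂P =
      ∫ ω, (Y ω - s) * (if q < Y ω then (1:ℝ) else 0) ∂P + s * (P {ω | q < Y ω}).toReal := by
    rw [← h_mass, ← integral_const_mul, ← integral_add h_centered (h_ind_int.const_mul s)]
    congr 1 with ω
    ring
  have hp : 0 < (P {ω | q < Y ω}).toReal := ENNReal.toReal_pos hq.ne' (measure_ne_top _ _)
  have hc : 0 < exp (-η₂ * (s - q)) := exp_pos _
  have h_scaled := h_centered.const_mul (exp (-η₂ * (s - q)))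
  rw [lt_div_iff₀ hp, div_lt_iff₀ hp, h_mean]
  constructor <;> intro h <;> by_contra! hη
  · have h_le := integral_mono h_scaled h_weighted fun ω => by
      dsimp only
      rw [← mul_assoc]
      exact mul_le_mul_of_nonneg_right
        (exp_mul_sub_le_of_nonneg (neg_nonneg.2 hη) q s (Y ω)) (by split_ifs <;> simp)
    rw [hzero, integral_const_mul] at h_le
    exact absurd h_le (not_le.2 (mul_pos hc (by linarith)))
  · have h_le := integral_mono h_weighted h_scaled fun ω => by
      dsimp only
      rw [← mul_assoc]
      exact mul_le_mul_of_nonneg_right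
        (exp_mul_sub_le_of_nonpos (neg_nonpos.2 hη) q s (Y ω)) (by split_ifs <;> simp)
    rw [hzero, integral_const_mul] at h_le
    exact absurd h_le (not_le.2 (mul_neg_of_pos_of_neg hc (by linarith)))
end
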